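/- Let d ≥ 2 and let γ = 0 or γ = −1/2. Then there are no q ≥ 1, distinct integers k_1,…,k_q in {1,…,d+1}, integer 2 ≤ p ≤ d, real a > 0 with a ≠ 1, and real numbers A_1,…,A_{q+1} such that w_γ ∫_{𝒯^{d+1}} f(ξ) ξ^γ dξ = Σ_{j=1}^q A_j · avg_{v_{k_j}𝒜_d} f + A_{q+1} · avg_{u_{a,p}𝒜_d} f holds for every homogeneous polynomial f of degree 6 in d+1 variables. -/

import Mathlib

open MeasureTheory Finset

/-- The standard simplex `T^d` in `ℝ^d`. -/
def Td (d : ℕ) : Set (Fin d → ℝ) :=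
  {x | (∀ i, 0 ≤ x i) ∧ ∑ i, x i ≤ 1}

/-- The weight function `W_γ(x) = (x_1 ⋯ x_d (1 - |x|₁))^γ` on `T^d`. -/
noncomputable def Wg (d : ℕ) (γ : ℝ) (x : Fin d → ℝ) : ℝ :=
  ((∏ i, x i) * (1 - ∑ i, x i)) ^ γ

/-- The normalization constant `w_γ = Γ((d+1)(γ+1)) / Γ(γ+1)^(d+1)`. -/
noncomputable def wg (d : ℕ) (γ : ℝ) : ℝ :=
  Real.Gamma ((d + 1) * (γ + 1)) / (Real.Gamma (γ + 1)) ^ (d + 1)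

/-- Homogeneous coordinates: `x ↦ (x, 1 - |x|₁) ∈ 𝒯^{d+1}`. -/
noncomputable def lift (d : ℕ) (x : Fin d → ℝ) : Fin (d + 1) → ℝ :=
  Fin.snoc x (1 - ∑ i, x i)

/-- Evaluation of the monomial symmetric polynomial with exponent vector `lv`:
the sum of all distinct monomials whose exponent vector is a permutation of `lv`. -/
noncomputable def msymmEval (d : ℕ) (lv : Fin (d + 1) → ℕ) (x : Fin (d + 1) → ℝ) : ℝ :=
  ∑ β ∈ Finset.image (fun σ : Equiv.Perm (Fin (d + 1)) => lv ∘ σ) Finset.univ,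
    ∏ i, x i ^ β i

/-- The average of `f` over the set of distinct coordinate permutations of `y`. -/
noncomputable def orbitAvg (d : ℕ) (y : Fin (d + 1) → ℝ) (f : (Fin (d + 1) → ℝ) → ℝ) : ℝ :=
  ((Finset.image (fun σ : Equiv.Perm (Fin (d + 1)) => y ∘ σ) Finset.univ).card : ℝ)⁻¹ *
    ∑ z ∈ Finset.image (fun σ : Equiv.Perm (Fin (d + 1)) => y ∘ σ) Finset.univ, f z

/-- `v_k = (1,…,1,0,…,0)` with `k` ones, in `d+1` coordinates. -/
def vk (d k : ℕ) : Fin (d + 1) → ℝ :=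
  fun i => if (i : ℕ) < k then 1 else 0

/-- `u_{a,p} = (a,1,…,1,0,…,0)` with one entry `a` followed by `p` ones. -/
def uap (d : ℕ) (a : ℝ) (p : ℕ) : Fin (d + 1) → ℝ :=
  fun i => if (i : ℕ) = 0 then a else if (i : ℕ) ≤ p then 1 else 0

open scoped ENNReal

/-- The density `y^(s-1)` on `[0, ∞)`, extended by zero. -/
noncomputable def rpowDensity (s y : ℝ) : ℝ≥0∞ :=
  if 0 ≤ y then ENNReal.ofReal (y ^ (s - 1)) else 0

lemma measurable_rpowDensity (s : ℝ) : Measurable (rpowDensity s) := by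
  unfold rpowDensity
  exact Measurable.ite measurableSet_Ici (by fun_prop) measurable_const

lemma rpowDensity_mul (s : ℝ) {t : ℝ} (ht : 0 < t) (y : ℝ) :
    rpowDensity s (t * y) = ENNReal.ofReal (t ^ (s - 1)) * rpowDensity s y := by
  unfold rpowDensity
  by_cases hy : 0 ≤ y
  · rw [if_pos hy, if_pos (by positivity), Real.mul_rpow ht.le hy,
      ENNReal.ofReal_mul (by positivity)]
  · rw [if_neg hy, if_neg (by simpa [mul_nonneg_iff_of_pos_left ht] using hy), mul_zero]

lemma lintegral_rpowDensity_mul_exp_neg {s : ℝ} (hs : 0 < s) :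
    ∫⁻ y, rpowDensity s y * ENNReal.ofReal (Real.exp (-y)) = ENNReal.ofReal (Real.Gamma s) := by
  have h : ∀ y, rpowDensity s y * ENNReal.ofReal (Real.exp (-y)) =
      (Set.Ici (0 : ℝ)).indicator
        (fun y => ENNReal.ofReal (Real.exp (-y) * y ^ (s - 1))) y := by
    intro y
    by_cases hy : 0 ≤ y
    · rw [Set.indicator_of_mem (Set.mem_Ici.2 hy), rpowDensity, if_pos hy,
        ENNReal.ofReal_mul (by positivity), mul_comm]
    · rw [Set.indicator_of_notMem (by simpa using hy), rpowDensity, if_neg hy, zero_mul]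
  simp_rw [h]
  rw [lintegral_indicator measurableSet_Ici, setLIntegral_congr Ioi_ae_eq_Ici.symm,
    Real.Gamma_eq_integral hs, ofReal_integral_eq_lintegral_ofReal
      (Real.GammaIntegral_convergent hs)]
  filter_upwards [ae_restrict_mem measurableSet_Ioi] with y hy
  have : (0 : ℝ) < y := hy
  positivity

lemma lintegral_fin_prod (d : ℕ) (f : Fin d → ℝ → ℝ≥0∞) (hf : ∀ i, Measurable (f i)) :
    ∫⁻ x : Fin d → ℝ, ∏ i, f i (x i) = ∏ i, ∫⁻ y, f i y := by
  induction d with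
  | zero => simp [volume_pi]
  | succ d ih =>
    have hm := (volume_preserving_piFinSuccAbove (fun _ : Fin (d + 1) => ℝ) 0).symm
    rw [← hm.lintegral_comp_emb (MeasurableEquiv.measurableEmbedding _), Fin.prod_univ_succ,
      ← ih (fun i => f i.succ) fun i => hf i.succ]
    simp only [MeasurableEquiv.piFinSuccAbove_symm_apply, Fin.prod_univ_succ,
      Fin.insertNthEquiv_apply, Fin.insertNth_zero', Fin.cons_zero, Fin.cons_succ]
    have hp : Measurable fun x : Fin d → ℝ => ∏ i : Fin d, f i.succ (x i) :=
      Finset.measurable_prod _ fun i _ => (hf i.succ).comp (measurable_pi_apply i)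
    exact lintegral_prod_mul (hf 0).aemeasurable hp.aemeasurable

lemma lintegral_comp_smul_fin {d : ℕ} {t : ℝ} (ht : 0 < t) {f : (Fin d → ℝ) → ℝ≥0∞}
    (hf : Measurable f) :
    ∫⁻ x, f x = ENNReal.ofReal (t ^ d) * ∫⁻ x, f (t • x) := by
  rw [← lintegral_map hf (measurable_const_smul t),
    Measure.map_addHaar_smul volume ht.ne', lintegral_smul_measure, smul_eq_mul, ← mul_assoc,
    ← ENNReal.ofReal_mul (by positivity), abs_of_pos (by positivity)]
  simp [ht.ne']

lemma lintegral_dirichlet (d : ℕ) (s : Fin d → ℝ) (r : ℝ) (hs : ∀ i, 0 < s i) (hr : 0 < r) :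
    ∫⁻ x : Fin d → ℝ, (∏ i, rpowDensity (s i) (x i)) * rpowDensity r (1 - ∑ i, x i) =
      ENNReal.ofReal ((∏ i, Real.Gamma (s i)) * Real.Gamma r / Real.Gamma (∑ i, s i + r)) := by
  set I := ∫⁻ x : Fin d → ℝ, (∏ i, rpowDensity (s i) (x i)) * rpowDensity r (1 - ∑ i, x i)
  have hS : 0 < ∑ i, s i + r := by
    have := Finset.sum_nonneg fun i (_ : i ∈ univ) => (hs i).le
    linarith
  have hφ := measurable_rpowDensity
  have hP : Measurable fun x : Fin d → ℝ => ∏ i, rpowDensity (s i) (x i) :=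
    Finset.measurable_prod _ fun i _ => (hφ _).comp (measurable_pi_apply i)
  have hD : ∀ t : ℝ, Measurable fun x : Fin d → ℝ =>
      (∏ i, rpowDensity (s i) (x i)) * rpowDensity r (t - ∑ i, x i) := fun t =>
    hP.mul ((hφ r).comp (by fun_prop))
  have hE : ∀ s : ℝ, Measurable fun y => rpowDensity s y * ENNReal.ofReal (Real.exp (-y)) :=
    fun s => (hφ s).mul (by fun_prop)
  have hsl : ∀ t : ℝ, t ≠ 0 →
      ∫⁻ x : Fin d → ℝ, (∏ i, rpowDensity (s i) (x i)) * rpowDensity r (t - ∑ i, x i) =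
        rpowDensity (∑ i, s i + r) t * I := by
    intro t ht
    rcases lt_or_gt_of_ne ht with ht | ht
    · rw [rpowDensity, if_neg (not_le.2 ht), zero_mul, lintegral_eq_zero_iff (hD t)]
      refine Filter.Eventually.of_forall fun x => ?_
      by_cases hx : ∀ i, 0 ≤ x i
      · have := Finset.sum_nonneg fun i (_ : i ∈ univ) => hx i
        have : ¬ 0 ≤ t - ∑ i, x i := by linarith
        simp [rpowDensity, this]
      · push Not at hx
        obtain ⟨i, hi⟩ := hx
        simp only [Pi.zero_apply, mul_eq_zero]
        exact Or.inl (Finset.prod_eq_zero (mem_univ i) (if_neg (not_le.2 hi)))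
    · rw [lintegral_comp_smul_fin ht (hD t)]
      have hsc : ∀ x : Fin d → ℝ,
          (∏ i, rpowDensity (s i) ((t • x) i)) * rpowDensity r (t - ∑ i, (t • x) i) =
            ENNReal.ofReal (t ^ (∑ i, (s i - 1) + (r - 1))) *
              ((∏ i, rpowDensity (s i) (x i)) * rpowDensity r (1 - ∑ i, x i)) := by
        intro x
        have h1 : t - ∑ i, (t • x) i = t * (1 - ∑ i, x i) := by
          simp [← Finset.mul_sum, mul_sub]
        rw [h1, rpowDensity_mul r ht]
        simp only [Pi.smul_apply, smul_eq_mul, rpowDensity_mul _ ht, Finset.prod_mul_distrib]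
        rw [Real.rpow_add ht, ENNReal.ofReal_mul (by positivity), Real.rpow_sum_of_pos ht,
          ENNReal.ofReal_prod_of_nonneg fun i _ => by positivity]
        ring
      simp_rw [hsc]
      rw [lintegral_const_mul _ (hD 1), ← mul_assoc,
        ← ENNReal.ofReal_mul (by positivity), rpowDensity, if_pos ht.le, ← Real.rpow_natCast,
        ← Real.rpow_add ht]
      have he : (d : ℝ) + (∑ i, (s i - 1) + (r - 1)) = ∑ i, s i + r - 1 := by
        rw [Finset.sum_sub_distrib, Finset.sum_const, card_univ, Fintype.card_fin, nsmul_one]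
        ring
      rw [he]
  have key : I * ENNReal.ofReal (Real.Gamma (∑ i, s i + r)) =
      ENNReal.ofReal ((∏ i, Real.Gamma (s i)) * Real.Gamma r) := by
    have hmeas : Measurable fun z : ℝ × (Fin d → ℝ) =>
        (∏ i, rpowDensity (s i) (z.2 i)) * rpowDensity r (z.1 - ∑ i, z.2 i) *
          ENNReal.ofReal (Real.exp (-z.1)) :=
      ((hP.comp measurable_snd).mul ((hφ r).comp (by fun_prop))).mul (by fun_prop)
    have h0 : ∀ᵐ t : ℝ, t ≠ 0 := by simp [ae_iff]
    calc I * ENNReal.ofReal (Real.Gamma (∑ i, s i + r))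
        = ∫⁻ t : ℝ, ∫⁻ x : Fin d → ℝ, (∏ i, rpowDensity (s i) (x i)) *
            rpowDensity r (t - ∑ i, x i) * ENNReal.ofReal (Real.exp (-t)) := by
          rw [← lintegral_rpowDensity_mul_exp_neg hS,
            ← lintegral_const_mul _ (hE _)]
          refine lintegral_congr_ae ?_
          filter_upwards [h0] with t ht
          rw [lintegral_mul_const _ (hD t), hsl t ht]
          ring
      _ = ∫⁻ x : Fin d → ℝ, ∫⁻ t : ℝ, (∏ i, rpowDensity (s i) (x i)) *
            rpowDensity r (t - ∑ i, x i) * ENNReal.ofReal (Real.exp (-t)) :=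
          lintegral_lintegral_swap hmeas.aemeasurable
      _ = ∫⁻ x : Fin d → ℝ,
            (∏ i, rpowDensity (s i) (x i) * ENNReal.ofReal (Real.exp (-x i))) *
              ENNReal.ofReal (Real.Gamma r) := by
          refine lintegral_congr fun x => ?_
          rw [← lintegral_rpowDensity_mul_exp_neg hr,
            ← lintegral_const_mul _ (hE _),
            ← lintegral_add_right_eq_self _ (∑ i, x i)]
          refine lintegral_congr fun u => ?_
          rw [add_sub_cancel_right, neg_add, Real.exp_add, ENNReal.ofReal_mul (by positivity),
            ← Finset.sum_neg_distrib, Real.exp_sum,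
            ENNReal.ofReal_prod_of_nonneg fun i _ => by positivity, Finset.prod_mul_distrib]
          ring
      _ = ENNReal.ofReal ((∏ i, Real.Gamma (s i)) * Real.Gamma r) := by
          have hp : Measurable fun x : Fin d → ℝ =>
              ∏ i, rpowDensity (s i) (x i) * ENNReal.ofReal (Real.exp (-x i)) :=
            Finset.measurable_prod _ fun i _ => (hE (s i)).comp (measurable_pi_apply i)
          rw [lintegral_mul_const _ hp,
            lintegral_fin_prod d (fun i y => rpowDensity (s i) y * ENNReal.ofReal (Real.exp (-y)))
              fun i => hE (s i),
            ENNReal.ofReal_mul (Finset.prod_nonneg fun i _ => (Real.Gamma_pos_of_pos (hs i)).le),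
            ENNReal.ofReal_prod_of_nonneg fun i _ => (Real.Gamma_pos_of_pos (hs i)).le]
          simp_rw [lintegral_rpowDensity_mul_exp_neg (hs _)]
  have hΓ := Real.Gamma_pos_of_pos hS
  rw [ENNReal.ofReal_div_of_pos hΓ, ENNReal.eq_div_iff (by simpa using hΓ) (by simp), mul_comm]
  exact key

lemma measurableSet_Td (d : ℕ) : MeasurableSet (Td d) :=
  (measurableSet_Ici (a := (0 : Fin d → ℝ))).inter
    (measurableSet_le (f := fun x : Fin d → ℝ => ∑ i, x i) (by fun_prop) measurable_const)

lemma lift_nonneg {d : ℕ} {x : Fin d → ℝ} (hx : x ∈ Td d) (i : Fin (d + 1)) : 0 ≤ lift d x i := by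
  induction i using Fin.lastCases with
  | last => simpa [lift] using hx.2
  | cast i => simpa [lift] using hx.1 i

lemma measurable_lift (d : ℕ) (i : Fin (d + 1)) : Measurable fun x => lift d x i := by
  induction i using Fin.lastCases with
  | last => simp only [lift, Fin.snoc_last]; fun_prop
  | cast i => simp only [lift, Fin.snoc_castSucc]; fun_prop

lemma Wg_eq_prod {d : ℕ} (γ : ℝ) {x : Fin d → ℝ} (hx : x ∈ Td d) :
    Wg d γ x = ∏ i, lift d x i ^ γ := by
  rw [Real.finsetProd_rpow _ _ fun i _ => lift_nonneg hx i, Fin.prod_univ_castSucc]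
  simp [lift, Wg]

lemma pow_mul_rpow {γ : ℝ} (hγ : -1 < γ) {y : ℝ} (hy : 0 ≤ y) (k : ℕ) :
    y ^ k * y ^ γ = y ^ (k + (γ + 1) - 1) := by
  rcases k.eq_zero_or_pos with rfl | hk
  · simp
  · have hk' : (1 : ℝ) ≤ k := by exact_mod_cast hk
    rw [add_sub_assoc, add_sub_cancel_right, Real.rpow_add' hy (by linarith), Real.rpow_natCast]

lemma integrableOn_integral_monomial (d : ℕ) {γ : ℝ} (hγ : -1 < γ) (α : Fin (d + 1) → ℕ) :
    IntegrableOn (fun x => (∏ i, lift d x i ^ α i) * Wg d γ x) (Td d) ∧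
      ∫ x in Td d, (∏ i, lift d x i ^ α i) * Wg d γ x =
        (∏ i, Real.Gamma (α i + (γ + 1))) / Real.Gamma (∑ i, (α i + (γ + 1))) := by
  have hpos : ∀ i, (0 : ℝ) < α i + (γ + 1) := fun i => by
    have : (0 : ℝ) ≤ α i := Nat.cast_nonneg _
    linarith
  have hnn : 0 ≤ᵐ[volume.restrict (Td d)] fun x => (∏ i, lift d x i ^ α i) * Wg d γ x := by
    filter_upwards [ae_restrict_mem (measurableSet_Td d)] with x hx
    rw [Wg_eq_prod γ hx]
    exact mul_nonneg (Finset.prod_nonneg fun i _ => pow_nonneg (lift_nonneg hx i) _)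
      (Finset.prod_nonneg fun i _ => Real.rpow_nonneg (lift_nonneg hx i) _)
  have hmeas : Measurable fun x => (∏ i, lift d x i ^ α i) * Wg d γ x := by
    refine (Finset.measurable_prod _ fun i _ => (measurable_lift d i).pow_const _).mul ?_
    unfold Wg
    fun_prop
  have hlin : ∫⁻ x in Td d, ENNReal.ofReal ((∏ i, lift d x i ^ α i) * Wg d γ x) =
      ENNReal.ofReal
        ((∏ i, Real.Gamma (α i + (γ + 1))) / Real.Gamma (∑ i, (α i + (γ + 1)))) := by
    rw [Fin.prod_univ_castSucc, Fin.sum_univ_castSucc,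
      ← lintegral_dirichlet d (fun i => α i.castSucc + (γ + 1)) _ (fun i => hpos _) (hpos _),
      ← lintegral_indicator (measurableSet_Td d)]
    refine lintegral_congr fun x => ?_
    by_cases hx : x ∈ Td d
    · rw [Set.indicator_of_mem hx, Wg_eq_prod γ hx, ← Finset.prod_mul_distrib,
        Finset.prod_congr rfl fun i _ => pow_mul_rpow hγ (lift_nonneg hx i) (α i),
        ENNReal.ofReal_prod_of_nonneg fun i _ => Real.rpow_nonneg (lift_nonneg hx i) _,
        Fin.prod_univ_castSucc]
      have h2 : 0 ≤ 1 - ∑ i, x i := sub_nonneg.2 hx.2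
      simp [lift, rpowDensity, hx.1, h2]
    · rw [Set.indicator_of_notMem hx, eq_comm, mul_eq_zero]
      by_cases h : ∀ i, 0 ≤ x i
      · exact Or.inr (if_neg fun h' => hx ⟨h, sub_nonneg.1 h'⟩)
      · push Not at h
        obtain ⟨i, hi⟩ := h
        exact Or.inl (Finset.prod_eq_zero (mem_univ i) (if_neg (not_le.2 hi)))
  refine ⟨(lintegral_ofReal_ne_top_iff_integrable hmeas.aestronglyMeasurable hnn).1
    (hlin ▸ ENNReal.ofReal_ne_top), ?_⟩
  rw [integral_eq_lintegral_of_nonneg_ae hnn hmeas.aestronglyMeasurable, hlin,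
    ENNReal.toReal_ofReal]
  exact div_nonneg (Finset.prod_nonneg fun i _ => (Real.Gamma_pos_of_pos (hpos i)).le)
    (Real.Gamma_nonneg_of_nonneg (Finset.sum_nonneg fun i _ => (hpos i).le))

lemma Gamma_nat_add {c : ℝ} (hc : 0 < c) (k : ℕ) :
    Real.Gamma (k + c) = (ascPochhammer ℝ k).eval c * Real.Gamma c := by
  induction k with
  | zero => simp
  | succ k ih =>
    rw [ascPochhammer_succ_eval, Nat.cast_succ, add_right_comm,
      Real.Gamma_add_one (by positivity), ih]
    ring

/-- The common factor of all degree six moments of the Dirichlet weight `W_γ` on `T^(m+2)`. -/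
noncomputable def momentFactor (m : ℕ) (γ : ℝ) : ℝ :=
  Real.Gamma (γ + 1) ^ (m + 3) / Real.Gamma (6 + (m + 3) * (γ + 1))

lemma momentFactor_pos (m : ℕ) {γ : ℝ} (hγ : -1 < γ) : 0 < momentFactor m γ := by
  have h : 0 < γ + 1 := by linarith
  exact div_pos (pow_pos (Real.Gamma_pos_of_pos h) _) (Real.Gamma_pos_of_pos (by positivity))

lemma integrableOn_integral_trinomial (m : ℕ) {γ : ℝ} (hγ : -1 < γ) {a b c : ℕ}
    (habc : a + b + c = 6) :
    IntegrableOn (fun x => lift (m + 2) x 0 ^ a * lift (m + 2) x 1 ^ b * lift (m + 2) x 2 ^ c *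
        Wg (m + 2) γ x) (Td (m + 2)) ∧
      ∫ x in Td (m + 2), lift (m + 2) x 0 ^ a * lift (m + 2) x 1 ^ b * lift (m + 2) x 2 ^ c *
          Wg (m + 2) γ x =
        momentFactor m γ * ((ascPochhammer ℝ a).eval (γ + 1) * (ascPochhammer ℝ b).eval (γ + 1) *
          (ascPochhammer ℝ c).eval (γ + 1)) := by
  have hc : 0 < γ + 1 := by linarith
  have h := integrableOn_integral_monomial (m + 2) hγ
    (Fin.cons a (Fin.cons b (Fin.cons c fun _ => 0)))
  have hprod : ∀ y : Fin (m + 2 + 1) → ℝ,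
      ∏ i, y i ^ (Fin.cons a (Fin.cons b (Fin.cons c fun _ => 0)) : Fin (m + 2 + 1) → ℕ) i =
        y 0 ^ a * y 1 ^ b * y 2 ^ c := by
    intro y
    simp [Fin.prod_univ_succ, mul_assoc]
  simp_rw [hprod] at h
  refine ⟨h.1, h.2.trans ?_⟩
  have habc' : (a : ℝ) + b + c = 6 := by exact_mod_cast habc
  have hsum : ∑ i, (((Fin.cons a (Fin.cons b (Fin.cons c fun _ => 0)) :
      Fin (m + 2 + 1) → ℕ) i : ℝ) + (γ + 1)) = 6 + (m + 3) * (γ + 1) := by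
    rw [← habc']
    simp [Fin.sum_univ_succ]
    ring
  rw [hsum, momentFactor]
  simp only [Fin.prod_univ_succ, Fin.cons_zero, Fin.cons_succ, Gamma_nat_add hc]
  simp
  ring

/-- The polynomial `∑ w x₀^a x₁^b x₂^c` over a list of terms `(w, a, b, c)`. -/
noncomputable def trinomialSum (m : ℕ) (L : List (ℝ × ℕ × ℕ × ℕ)) :
    MvPolynomial (Fin (m + 2 + 1)) ℝ :=
  (L.map fun t => MvPolynomial.C t.1 *
    (MvPolynomial.X 0 ^ t.2.1 * MvPolynomial.X 1 ^ t.2.2.1 * MvPolynomial.X 2 ^ t.2.2.2)).sum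

lemma trinomialSum_isHomogeneous (m : ℕ) (L : List (ℝ × ℕ × ℕ × ℕ))
    (hL : ∀ t ∈ L, t.2.1 + t.2.2.1 + t.2.2.2 = 6) : (trinomialSum m L).IsHomogeneous 6 := by
  induction L with
  | nil => exact MvPolynomial.isHomogeneous_zero _ _ _
  | cons t L ih =>
    rw [List.forall_mem_cons] at hL
    refine MvPolynomial.IsHomogeneous.add (MvPolynomial.IsHomogeneous.C_mul ?_ _) (ih hL.2)
    have h := (((MvPolynomial.isHomogeneous_X ℝ (0 : Fin (m + 2 + 1))).pow t.2.1).mul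
      ((MvPolynomial.isHomogeneous_X ℝ (1 : Fin (m + 2 + 1))).pow t.2.2.1)).mul
      ((MvPolynomial.isHomogeneous_X ℝ (2 : Fin (m + 2 + 1))).pow t.2.2.2)
    simpa only [one_mul, hL.1] using h

lemma eval_trinomialSum (m : ℕ) (L : List (ℝ × ℕ × ℕ × ℕ)) (y : Fin (m + 2 + 1) → ℝ) :
    MvPolynomial.eval y (trinomialSum m L) =
      (L.map fun t => t.1 * (y 0 ^ t.2.1 * y 1 ^ t.2.2.1 * y 2 ^ t.2.2.2)).sum := by
  induction L with
  | nil => simp [trinomialSum]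
  | cons t L ih =>
    rw [List.map_cons, List.sum_cons, ← ih]
    simp [trinomialSum]

lemma integrableOn_integral_trinomialSum (m : ℕ) {γ : ℝ} (hγ : -1 < γ)
    (L : List (ℝ × ℕ × ℕ × ℕ)) (hL : ∀ t ∈ L, t.2.1 + t.2.2.1 + t.2.2.2 = 6) :
    IntegrableOn (fun x => MvPolynomial.eval (lift (m + 2) x) (trinomialSum m L) *
        Wg (m + 2) γ x) (Td (m + 2)) ∧
      ∫ x in Td (m + 2), MvPolynomial.eval (lift (m + 2) x) (trinomialSum m L) *
          Wg (m + 2) γ x =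
        momentFactor m γ * (L.map fun t => t.1 * ((ascPochhammer ℝ t.2.1).eval (γ + 1) *
          (ascPochhammer ℝ t.2.2.1).eval (γ + 1) * (ascPochhammer ℝ t.2.2.2).eval (γ + 1))).sum := by
  simp only [eval_trinomialSum]
  induction L with
  | nil => simp
  | cons t L ih =>
    rw [List.forall_mem_cons] at hL
    have h1 := integrableOn_integral_trinomial m hγ hL.1
    have h2 := ih hL.2
    simp only [List.map_cons, List.sum_cons, add_mul, mul_assoc t.1]
    refine ⟨(h1.1.const_mul _).add h2.1, ?_⟩
    rw [integral_add (h1.1.const_mul _) h2.1, integral_const_mul, h1.2, h2.2]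
    ring

lemma orbitAvg_eq_zero {d : ℕ} {y : Fin (d + 1) → ℝ} {f : (Fin (d + 1) → ℝ) → ℝ}
    (h : ∀ σ : Equiv.Perm (Fin (d + 1)), f (y ∘ σ) = 0) : orbitAvg d y f = 0 := by
  rw [orbitAvg, Finset.sum_eq_zero, mul_zero]
  intro z hz
  obtain ⟨σ, -, rfl⟩ := Finset.mem_image.1 hz
  exact h σ

lemma wg_pos (d : ℕ) {γ : ℝ} (hγ : -1 < γ) : 0 < wg d γ := by
  have h : 0 < γ + 1 := by linarith
  exact div_pos (Real.Gamma_pos_of_pos (by positivity)) (pow_pos (Real.Gamma_pos_of_pos h) _)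

lemma vk_eq_zero_or_one (d k : ℕ) (i : Fin (d + 1)) : vk d k i = 0 ∨ vk d k i = 1 := by
  unfold vk
  split_ifs <;> simp

/-- Coefficients and exponents of a combination of two symmetrized forms in `x₀, x₁`, both
divisible by `x₀ x₁ (x₀ - x₁)²`, that vanishes at `(a, 1)`. -/
def pairTerms (a : ℝ) : List (ℝ × ℕ × ℕ × ℕ) :=
  [(a, 5, 1, 0), (a, 1, 5, 0), (-(a + 1) ^ 2, 4, 2, 0), (-(a + 1) ^ 2, 2, 4, 0),
    (2 * (a ^ 2 + a + 1), 3, 3, 0)]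

/-- Coefficients and exponents of a symmetric form in `x₀, x₁, x₂`, divisible by `x₀ x₁ x₂`,
that vanishes at `(1, 1, 1)` and `(a, 1, 1)`. -/
def tripleTerms (a : ℝ) : List (ℝ × ℕ × ℕ × ℕ) :=
  [(2, 4, 1, 1), (2, 1, 4, 1), (2, 1, 1, 4),
    (-(a + 2), 3, 2, 1), (-(a + 2), 3, 1, 2), (-(a + 2), 2, 3, 1),
    (-(a + 2), 1, 3, 2), (-(a + 2), 2, 1, 3), (-(a + 2), 1, 2, 3),
    (6 * (a + 1), 2, 2, 2)]

lemma uap_comp_perm (d : ℕ) (a : ℝ) (p : ℕ) (σ : Equiv.Perm (Fin (d + 1))) (i : Fin (d + 1)) :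
    (uap d a p ∘ σ) i = 0 ∨ (uap d a p ∘ σ) i = 1 ∨ ((uap d a p ∘ σ) i = a ∧ σ i = 0) := by
  simp only [Function.comp_apply, uap]
  split_ifs with h
  · exact Or.inr (Or.inr ⟨rfl, Fin.ext h⟩)
  · simp
  · simp

lemma eval_pairTerms_vk (m k : ℕ) (a : ℝ) (σ : Equiv.Perm (Fin (m + 2 + 1))) :
    MvPolynomial.eval (vk (m + 2) k ∘ σ) (trinomialSum m (pairTerms a)) = 0 := by
  rw [eval_trinomialSum]
  rcases vk_eq_zero_or_one (m + 2) k (σ 0) with h0 | h0 <;>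
  rcases vk_eq_zero_or_one (m + 2) k (σ 1) with h1 | h1 <;>
  simp [pairTerms, h0, h1]
  ring

lemma eval_tripleTerms_vk (m k : ℕ) (a : ℝ) (σ : Equiv.Perm (Fin (m + 2 + 1))) :
    MvPolynomial.eval (vk (m + 2) k ∘ σ) (trinomialSum m (tripleTerms a)) = 0 := by
  rw [eval_trinomialSum]
  rcases vk_eq_zero_or_one (m + 2) k (σ 0) with h0 | h0 <;>
  rcases vk_eq_zero_or_one (m + 2) k (σ 1) with h1 | h1 <;>
  rcases vk_eq_zero_or_one (m + 2) k (σ 2) with h2 | h2 <;>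
  simp [tripleTerms, h0, h1, h2]
  ring

lemma eval_pairTerms_uap (m p : ℕ) (a : ℝ) (σ : Equiv.Perm (Fin (m + 2 + 1))) :
    MvPolynomial.eval (uap (m + 2) a p ∘ σ) (trinomialSum m (pairTerms a)) = 0 := by
  rw [eval_trinomialSum]
  have h01 : σ 0 ≠ σ 1 := σ.injective.ne (by simp)
  rcases uap_comp_perm (m + 2) a p σ 0 with h0 | h0 | ⟨h0, h0'⟩ <;>
  rcases uap_comp_perm (m + 2) a p σ 1 with h1 | h1 | ⟨h1, h1'⟩ <;>
  first
  | exact absurd (h0'.trans h1'.symm) h01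
  | (simp only [pairTerms, List.map_cons, List.map_nil, List.sum_cons, List.sum_nil, h0, h1]
     ring)

lemma eval_tripleTerms_uap (m p : ℕ) (a : ℝ) (σ : Equiv.Perm (Fin (m + 2 + 1))) :
    MvPolynomial.eval (uap (m + 2) a p ∘ σ) (trinomialSum m (tripleTerms a)) = 0 := by
  rw [eval_trinomialSum]
  have h01 : σ 0 ≠ σ 1 := σ.injective.ne (by simp)
  have h02 : σ 0 ≠ σ 2 := σ.injective.ne (by simp [Fin.ext_iff, Nat.mod_eq_of_lt])
  have h12 : σ 1 ≠ σ 2 := σ.injective.ne (by simp [Fin.ext_iff, Nat.mod_eq_of_lt])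
  rcases uap_comp_perm (m + 2) a p σ 0 with h0 | h0 | ⟨h0, h0'⟩ <;>
  rcases uap_comp_perm (m + 2) a p σ 1 with h1 | h1 | ⟨h1, h1'⟩ <;>
  rcases uap_comp_perm (m + 2) a p σ 2 with h2 | h2 | ⟨h2, h2'⟩ <;>
  first
  | exact absurd (h0'.trans h1'.symm) h01
  | exact absurd (h0'.trans h2'.symm) h02
  | exact absurd (h1'.trans h2'.symm) h12
  | (simp only [tripleTerms, List.map_cons, List.map_nil, List.sum_cons, List.sum_nil, h0, h1, h2]
     ring)

/-- For `γ = 0` and `γ = -1/2`, there is no cubature rule of index `6` of the considered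
form, whatever `q` and `a` are. -/
theorem no_cubature_index_six
    (d : ℕ) (hd : 2 ≤ d) (γ : ℝ) (hγ : γ = 0 ∨ γ = -(1 / 2)) :
    ¬ ∃ (q : ℕ) (_ : 1 ≤ q) (k : Fin q → ℕ) (_ : Function.Injective k)
        (_ : ∀ j, 1 ≤ k j) (_ : ∀ j, k j ≤ d + 1)
        (p : ℕ) (_ : 2 ≤ p) (_ : p ≤ d)
        (a : ℝ) (_ : 0 < a) (_ : a ≠ 1)
        (A : Fin q → ℝ) (Aq1 : ℝ),
      ∀ f : MvPolynomial (Fin (d + 1)) ℝ, f.IsHomogeneous 6 →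
        wg d γ * ∫ x in Td d, MvPolynomial.eval (lift d x) f * Wg d γ x
          = (∑ j, A j * orbitAvg d (vk d (k j)) (fun z => MvPolynomial.eval z f))
            + Aq1 * orbitAvg d (uap d a p) (fun z => MvPolynomial.eval z f) := by
  obtain ⟨m, rfl⟩ := Nat.exists_eq_add_of_le' hd
  have hγ1 : -1 < γ := by rcases hγ with rfl | rfl <;> norm_num
  rintro ⟨q, -, k, -, -, -, p, -, -, a, -, -, A, B, H⟩
  have vanish : ∀ L : List (ℝ × ℕ × ℕ × ℕ), (∀ t ∈ L, t.2.1 + t.2.2.1 + t.2.2.2 = 6) →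
      (∀ (k : ℕ) (σ : Equiv.Perm _), MvPolynomial.eval (vk (m + 2) k ∘ σ) (trinomialSum m L) = 0) →
      (∀ σ : Equiv.Perm _, MvPolynomial.eval (uap (m + 2) a p ∘ σ) (trinomialSum m L) = 0) →
      (L.map fun t => t.1 * ((ascPochhammer ℝ t.2.1).eval (γ + 1) *
        (ascPochhammer ℝ t.2.2.1).eval (γ + 1) *
          (ascPochhammer ℝ t.2.2.2).eval (γ + 1))).sum = 0 := by
    intro L hL hv hu
    have h := H _ (trinomialSum_isHomogeneous m L hL)
    rw [(integrableOn_integral_trinomialSum m hγ1 L hL).2,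
      Finset.sum_eq_zero fun j _ => by rw [orbitAvg_eq_zero (hv (k j)), mul_zero],
      orbitAvg_eq_zero hu, mul_zero, add_zero] at h
    simpa [(wg_pos (m + 2) hγ1).ne', (momentFactor_pos m hγ1).ne'] using h
  have h1 := vanish (pairTerms a) (by simp [pairTerms]) (fun k => eval_pairTerms_vk m k a)
    (eval_pairTerms_uap m p a)
  have h2 := vanish (tripleTerms a) (by simp [tripleTerms]) (fun k => eval_tripleTerms_vk m k a)
    (eval_tripleTerms_uap m p a)
  simp only [pairTerms, tripleTerms, List.map_cons, List.map_nil, List.sum_cons, List.sum_nil,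
    ascPochhammer_succ_eval, ascPochhammer_zero, Polynomial.eval_one] at h1 h2
  rcases hγ with rfl | rfl
  · norm_num at h1 h2
    have ha : a = 2 := by linarith
    subst ha
    norm_num at h1
  · norm_num at h1 h2
    have ha : a = 7 / 3 := by linarith
    subst ha
    norm_num at h1
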